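/- Let I be the ideal of K[u₂, u₃, v₂, v₃, v₄] generated by the coefficients of all powers of z in the polynomial (1 + u₂z² + u₃z³)⁴ − (1 + v₂z² + v₃z³ + v₄z⁴)³. Then u₂u₃ ∈ I and 2u₂³ − 9u₃² ∈ I. (These are the paper's defining relations u₂u₃ = 0 and (2/9)u₂³ = u₃² for the reduced uncolored Koszul model 𝓜_{3,4}(1) of the (3,4) torus knot.) -/

import Mathlib

noncomputable section

variable (K : Type*) [Field K] [CharZero K]

/-- The variable `u₂` of `K[u₂, u₃, v₂, v₃, v₄]`. -/
def u₂ : MvPolynomial (Fin 5) K := MvPolynomial.X 0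
/-- The variable `u₃` of `K[u₂, u₃, v₂, v₃, v₄]`. -/
def u₃ : MvPolynomial (Fin 5) K := MvPolynomial.X 1
/-- The variable `v₂` of `K[u₂, u₃, v₂, v₃, v₄]`. -/
def v₂ : MvPolynomial (Fin 5) K := MvPolynomial.X 2
/-- The variable `v₃` of `K[u₂, u₃, v₂, v₃, v₄]`. -/
def v₃ : MvPolynomial (Fin 5) K := MvPolynomial.X 3
/-- The variable `v₄` of `K[u₂, u₃, v₂, v₃, v₄]`. -/
def v₄ : MvPolynomial (Fin 5) K := MvPolynomial.X 4

/-- The polynomial `(1 + u₂z² + u₃z³)⁴ − (1 + v₂z² + v₃z³ + v₄z⁴)³` in `z`, with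
coefficients in `K[u₂, u₃, v₂, v₃, v₄]`. -/
def t34Poly : Polynomial (MvPolynomial (Fin 5) K) :=
  (1 + Polynomial.C (u₂ K) * Polynomial.X ^ 2
      + Polynomial.C (u₃ K) * Polynomial.X ^ 3) ^ 4
    - (1 + Polynomial.C (v₂ K) * Polynomial.X ^ 2
        + Polynomial.C (v₃ K) * Polynomial.X ^ 3
        + Polynomial.C (v₄ K) * Polynomial.X ^ 4) ^ 3

/-- The ideal generated by the coefficients of all powers of `z` in
`(1 + u₂z² + u₃z³)⁴ − (1 + v₂z² + v₃z³ + v₄z⁴)³`. -/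
def t34Ideal : Ideal (MvPolynomial (Fin 5) K) :=
  Ideal.span (Set.range fun k : ℕ => (t34Poly K).coeff k)

/-- Nonzero integers are units in a polynomial ring over a field of characteristic zero, so they
can be cancelled from membership in an ideal. -/
theorem mem_of_natCast_mul_mem {F σ : Type*} [Field F] [CharZero F]
    {I : Ideal (MvPolynomial σ F)} {n : ℕ} (hn : n ≠ 0) {p : MvPolynomial σ F}
    (h : (n : MvPolynomial σ F) * p ∈ I) : p ∈ I := by
  have hu : IsUnit (n : MvPolynomial σ F) := by
    simpa using (IsUnit.mk0 (n : F) (Nat.cast_ne_zero.mpr hn)).map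
      (MvPolynomial.C : F →+* MvPolynomial σ F)
  exact (Ideal.unit_mul_mem_iff_mem I hu).mp h

theorem t34Poly_eq (F : Type*) [Field F] : t34Poly F =
    Polynomial.C (4 * u₂ F - 3 * v₂ F) * Polynomial.X ^ 2
    + Polynomial.C (4 * u₃ F - 3 * v₃ F) * Polynomial.X ^ 3
    + Polynomial.C (6 * u₂ F ^ 2 - 3 * v₄ F - 3 * v₂ F ^ 2) * Polynomial.X ^ 4
    + Polynomial.C (12 * u₂ F * u₃ F - 6 * v₂ F * v₃ F) * Polynomial.X ^ 5
    + Polynomial.C (4 * u₂ F ^ 3 + 6 * u₃ F ^ 2 - v₂ F ^ 3 - 3 * v₃ F ^ 2 - 6 * v₂ F * v₄ F)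
      * Polynomial.X ^ 6
    + Polynomial.C (12 * u₂ F ^ 2 * u₃ F - 3 * v₂ F ^ 2 * v₃ F - 6 * v₃ F * v₄ F)
      * Polynomial.X ^ 7
    + Polynomial.C (u₂ F ^ 4 + 12 * u₂ F * u₃ F ^ 2 - 3 * v₂ F * v₃ F ^ 2 - 3 * v₂ F ^ 2 * v₄ F
      - 3 * v₄ F ^ 2) * Polynomial.X ^ 8
    + Polynomial.C (4 * u₂ F ^ 3 * u₃ F + 4 * u₃ F ^ 3 - v₃ F ^ 3 - 6 * v₂ F * v₃ F * v₄ F)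
      * Polynomial.X ^ 9
    + Polynomial.C (6 * u₂ F ^ 2 * u₃ F ^ 2 - 3 * v₂ F * v₄ F ^ 2 - 3 * v₃ F ^ 2 * v₄ F)
      * Polynomial.X ^ 10
    + Polynomial.C (4 * u₂ F * u₃ F ^ 3 - 3 * v₃ F * v₄ F ^ 2) * Polynomial.X ^ 11
    + Polynomial.C (u₃ F ^ 4 - v₄ F ^ 3) * Polynomial.X ^ 12 := by
  simp only [t34Poly, map_sub, map_add, map_mul, map_pow, map_ofNat]
  ring

theorem coeff_t34Poly_mem (F : Type*) [Field F] (k : ℕ) : (t34Poly F).coeff k ∈ t34Ideal F :=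
  Ideal.subset_span ⟨k, rfl⟩

/-- For the reduced uncolored Koszul model `𝓜_{3,4}(1)` of the `(3,4)` torus knot:
`u₂u₃ ∈ I` and `2u₂³ − 9u₃² ∈ I`. -/
theorem t34_koszul_relations :
    u₂ K * u₃ K ∈ t34Ideal K ∧
    2 * u₂ K ^ 3 - 9 * u₃ K ^ 2 ∈ t34Ideal K := by
  have h₂ : 4 * u₂ K - 3 * v₂ K ∈ t34Ideal K := by
    simpa only [t34Poly_eq, Polynomial.coeff_add, Polynomial.coeff_C_mul_X_pow, Nat.reduceEqDiff,
      reduceIte, zero_add, add_zero] using coeff_t34Poly_mem K 2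
  have h₃ : 4 * u₃ K - 3 * v₃ K ∈ t34Ideal K := by
    simpa only [t34Poly_eq, Polynomial.coeff_add, Polynomial.coeff_C_mul_X_pow, Nat.reduceEqDiff,
      reduceIte, zero_add, add_zero] using coeff_t34Poly_mem K 3
  have h₄ : 6 * u₂ K ^ 2 - 3 * v₄ K - 3 * v₂ K ^ 2 ∈ t34Ideal K := by
    simpa only [t34Poly_eq, Polynomial.coeff_add, Polynomial.coeff_C_mul_X_pow, Nat.reduceEqDiff,
      reduceIte, zero_add, add_zero] using coeff_t34Poly_mem K 4
  have h₅ : 12 * u₂ K * u₃ K - 6 * v₂ K * v₃ K ∈ t34Ideal K := by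
    simpa only [t34Poly_eq, Polynomial.coeff_add, Polynomial.coeff_C_mul_X_pow, Nat.reduceEqDiff,
      reduceIte, zero_add, add_zero] using coeff_t34Poly_mem K 5
  have h₆ : 4 * u₂ K ^ 3 + 6 * u₃ K ^ 2 - v₂ K ^ 3 - 3 * v₃ K ^ 2 - 6 * v₂ K * v₄ K
      ∈ t34Ideal K := by
    simpa only [t34Poly_eq, Polynomial.coeff_add, Polynomial.coeff_C_mul_X_pow, Nat.reduceEqDiff,
      reduceIte, zero_add, add_zero] using coeff_t34Poly_mem K 6
  constructor
  · refine mem_of_natCast_mul_mem (n := 4) (by norm_num) ?_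
    convert sub_mem (sub_mem (Ideal.mul_mem_left _ 3 h₅) (Ideal.mul_mem_left _ (8 * u₂ K) h₃))
      (Ideal.mul_mem_left _ (6 * v₃ K) h₂) using 1
    push_cast
    ring
  · refine mem_of_natCast_mul_mem (n := 2) (by norm_num) ?_
    convert add_mem (add_mem (add_mem (Ideal.mul_mem_left _ (-27) h₆)
      (Ideal.mul_mem_left _ (54 * v₂ K) h₄))
      (Ideal.mul_mem_left _ (9 * (4 * u₃ K + 3 * v₃ K)) h₃))
      (Ideal.mul_mem_left _ (108 * u₂ K ^ 2
        - 5 * (16 * u₂ K ^ 2 + 12 * u₂ K * v₂ K + 9 * v₂ K ^ 2)) h₂) using 1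
    push_cast
    ring

end
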